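/- Let C be a preadditive category with finite biproducts, D a preadditive category, F : C ⥤ D an arbitrary functor, d a positive integer, and x : Fin d → C with biproduct X. Then for any finite collection of subsets U_1, …, U_n ⊆ Fin d, the composite (in any order, since the factors commute) of the endomorphisms 𝟙_{F(X)} − F.map(ψ_{U_α}) for α = 1, …, n equals ∑_V cr(V), where the sum ranges over all subsets V ⊆ Fin d that are not contained in any of U_1, …, U_n, and cr(V) = ∑_{W ⊆ V} (−1)^{|V|−|W|} F.map(ψ_W). -/

import Mathlib

open CategoryTheory CategoryTheory.Limits

/-- `psi x U = ∑_{i ∈ U} π_i ≫ ι_i`, an endomorphism of the biproduct `⨁ x`. -/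
noncomputable def psi {C : Type*} [Category C] [Preadditive C] [HasFiniteBiproducts C]
    {d : ℕ} (x : Fin d → C) (U : Finset (Fin d)) : (⨁ x) ⟶ (⨁ x) :=
  ∑ i ∈ U, biproduct.π x i ≫ biproduct.ι x i

/-- `cr F x U = ∑_{V ⊆ U} (−1)^{|U|−|V|} F.map (ψ_V)`, an endomorphism of `F(⨁ x)`. -/
noncomputable def cr {C : Type*} [Category C] [Preadditive C] [HasFiniteBiproducts C]
    {D : Type*} [Category D] [Preadditive D] {d : ℕ} (F : C ⥤ D) (x : Fin d → C)
    (U : Finset (Fin d)) : F.obj (⨁ x) ⟶ F.obj (⨁ x) :=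
  ∑ V ∈ U.powerset, ((-1 : ℤ) ^ (U.card - V.card)) • F.map (psi x V)

section AlternatingSum

variable {ι A : Type*} [DecidableEq ι] [AddCommGroup A]

/-- The alternating sum `∑_{t ⊆ s} (−1)^{|s|−|t|} f t`. -/
def alternatingSum (f : Finset ι → A) (s : Finset ι) : A :=
  ∑ t ∈ s.powerset, ((-1 : ℤ) ^ (s.card - t.card)) • f t

theorem alternatingSum_insert (f : Finset ι → A) {i : ι} {s : Finset ι} (hi : i ∉ s) :
    alternatingSum f (insert i s) =
      alternatingSum (fun t => f (insert i t)) s - alternatingSum f s := by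
  unfold alternatingSum
  rw [Finset.sum_powerset_insert hi, sub_eq_add_neg, add_comm, ← Finset.sum_neg_distrib]
  congr 1 <;> refine Finset.sum_congr rfl fun t ht => ?_
  · have hit : i ∉ t := fun h => hi (Finset.mem_powerset.mp ht h)
    rw [Finset.card_insert_of_notMem hi, Finset.card_insert_of_notMem hit,
      Nat.add_sub_add_right]
  · have hle := Finset.card_le_card (Finset.mem_powerset.mp ht)
    rw [Finset.card_insert_of_notMem hi, Nat.sub_add_comm hle, pow_succ, mul_neg_one, neg_smul]

/-- Möbius inversion on the Boolean lattice. -/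
theorem sum_powerset_alternatingSum (f : Finset ι → A) (s : Finset ι) :
    ∑ t ∈ s.powerset, alternatingSum f t = f s := by
  induction s using Finset.induction_on generalizing f with
  | empty => simp [alternatingSum]
  | insert i s hi ih =>
    rw [Finset.sum_powerset_insert hi, ← ih fun t => f (insert i t), ← Finset.sum_add_distrib]
    refine Finset.sum_congr rfl fun t ht => ?_
    rw [alternatingSum_insert f fun h => hi (Finset.mem_powerset.mp ht h)]
    abel

theorem alternatingSum_eq_zero (f : Finset ι → A) {i : ι} {s : Finset ι} (hi : i ∈ s)
    (hf : ∀ t, f (insert i t) = f t) : alternatingSum f s = 0 := by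
  rw [← Finset.insert_erase hi, alternatingSum_insert f (Finset.notMem_erase i s)]
  simp only [hf, sub_self]

end AlternatingSum

section CrossEffect

variable {C : Type*} [Category C] [Preadditive C] [HasFiniteBiproducts C]
  {D : Type*} [Category D] [Preadditive D] {d : ℕ}

theorem psi_univ (x : Fin d → C) : psi x Finset.univ = 𝟙 (⨁ x) :=
  biproduct.total

theorem psi_comp_psi (x : Fin d → C) (U V : Finset (Fin d)) :
    psi x U ≫ psi x V = psi x (U ∩ V) := by
  have h (i j : Fin d) : (biproduct.π x i ≫ biproduct.ι x i) ≫ biproduct.π x j ≫ biproduct.ι x j =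
      if i = j then biproduct.π x i ≫ biproduct.ι x i else 0 := by
    split_ifs with hij
    · subst hij; simp
    · simp [biproduct.ι_π_ne_assoc x hij]
  simp only [psi, Preadditive.sum_comp, Preadditive.comp_sum, h]
  rw [Finset.sum_comm]
  simp only [Finset.sum_ite_eq, Finset.sum_ite_mem]

theorem cr_eq_alternatingSum (F : C ⥤ D) (x : Fin d → C) (V : Finset (Fin d)) :
    cr F x V = alternatingSum (fun W => F.map (psi x W)) V :=
  rfl

theorem sum_cr (F : C ⥤ D) (x : Fin d → C) :
    ∑ V : Finset (Fin d), cr F x V = 𝟙 (F.obj (⨁ x)) := by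
  simp only [cr_eq_alternatingSum]
  rw [← Finset.powerset_univ, sum_powerset_alternatingSum, psi_univ, F.map_id]

theorem map_psi_comp_cr (F : C ⥤ D) (x : Fin d → C) (U V : Finset (Fin d)) :
    F.map (psi x U) ≫ cr F x V = if V ⊆ U then cr F x V else 0 := by
  have h : F.map (psi x U) ≫ cr F x V =
      alternatingSum (fun W => F.map (psi x (U ∩ W))) V := by
    simp only [cr, alternatingSum, Preadditive.comp_sum, Preadditive.comp_zsmul, ← F.map_comp,
      psi_comp_psi]
  rw [h]
  split_ifs with hVU
  · refine Finset.sum_congr rfl fun W hW => ?_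
    beta_reduce
    rw [Finset.inter_eq_right.mpr ((Finset.mem_powerset.mp hW).trans hVU)]
  · obtain ⟨i, hiV, hiU⟩ := Finset.not_subset.mp hVU
    exact alternatingSum_eq_zero _ hiV fun W => by rw [Finset.inter_insert_of_notMem hiU]

theorem foldr_one_sub_map_psi {κ : Type*} (F : C ⥤ D) (x : Fin d → C)
    (Us : κ → Finset (Fin d)) (L : List κ) :
    (L.map fun α => 𝟙 (F.obj (⨁ x)) - F.map (psi x (Us α))).foldr
        (· ≫ ·) (𝟙 (F.obj (⨁ x)))
      = ∑ V with ∀ α ∈ L, ¬ V ⊆ Us α, cr F x V := by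
  induction L with
  | nil => simp [sum_cr]
  | cons α L ih =>
    rw [List.map_cons, List.foldr_cons, ih, Preadditive.comp_sum, Finset.sum_filter,
      Finset.sum_filter]
    refine Finset.sum_congr rfl fun V _ => ?_
    rw [Preadditive.sub_comp, Category.id_comp, map_psi_comp_cr]
    by_cases hV : V ⊆ Us α <;> simp [hV]

end CrossEffect

/-- For any finite collection of subsets `U_1, …, U_n ⊆ Fin d`, the composite (in any order,
here along an arbitrary enumeration `L` of the indices) of the endomorphisms
`𝟙 − F.map (ψ_{U_α})` equals `∑ cr V`, the sum ranging over all `V ⊆ Fin d` not contained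
in any of the `U_α`. -/
theorem prod_one_sub_map_psi {C : Type*} [Category C] [Preadditive C]
    [HasFiniteBiproducts C] {D : Type*} [Category D] [Preadditive D] {d : ℕ} (hd : 0 < d)
    (F : C ⥤ D) (x : Fin d → C) (n : ℕ) (Us : Fin n → Finset (Fin d))
    (L : List (Fin n)) (hL : L.Perm (List.finRange n)) :
    (L.map fun α => 𝟙 (F.obj (⨁ x)) - F.map (psi x (Us α))).foldr
        (· ≫ ·) (𝟙 (F.obj (⨁ x)))
      = ∑ V ∈ Finset.univ.filter (fun V : Finset (Fin d) => ∀ α, ¬ V ⊆ Us α),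
          cr F x V := by
  simp [foldr_one_sub_map_psi, hL.mem_iff]
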